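/- arXiv:2006.12820 — 4 statements merged into one kernel-verified Lean document; each statement's English description precedes it below -/
import Mathlib

section
/- Let p ≥ 5 be a prime, let r be an integer with gcd(r, p−1) = 1 and 1 < r < p−1, and let a, v be elements of the finite field F_p with a ≠ 0 and v ≠ 0. Then the number of x ∈ F_p with x ≠ 0 satisfying a·x^r = x + v is at most 1 + (1 − 2/(p−1))·p^{1/2}. -/
/-- The absolute value of a Jacobi sum of nontrivial complex characters is at most `√p`. -/
lemma norm_jacobiSum_le (p : ℕ) [Fact p.Prime] {χ φ : MulChar (ZMod p) ℂ} (hχ : χ ≠ 1)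
    (hφ : φ ≠ 1) : ‖jacobiSum χ φ‖ ≤ Real.sqrt p := by
  have hp : (1 : ℝ) ≤ p := by exact_mod_cast (Fact.out : p.Prime).one_le
  by_cases h : χ * φ = 1
  · obtain rfl : φ = χ⁻¹ := (inv_eq_of_mul_eq_one_right h).symm
    rw [jacobiSum_nontrivial_inv hχ, norm_neg]
    exact (DirichletCharacter.norm_le_one (n := p) χ _).trans (Real.one_le_sqrt.mpr hp)
  · have h1 := jacobiSum_mul_jacobiSum_inv (F := ZMod p) (F' := ℂ)
      (by rw [ringChar.eq_zero, ZMod.ringChar_zmod_n]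
          exact (Fact.out : p.Prime).ne_zero.symm) hχ hφ h
    have h2 : jacobiSum χ⁻¹ φ⁻¹ = star (jacobiSum χ φ) := by
      simp only [jacobiSum, star_sum, star_mul', MulChar.star_apply']
    have h3 := congrArg norm h1
    rw [h2, norm_mul, norm_star, ZMod.card, Complex.norm_natCast] at h3
    apply Real.le_sqrt_of_sq_le
    rw [sq, h3]

/-- The character sums in question are Jacobi sums up to a unit factor. -/
lemma charSum_eq (p : ℕ) [Fact p.Prime] (r : ℕ) (hr : r ≠ 0) (a v : ZMod p)
    (hv : v ≠ 0) (χ : MulChar (ZMod p) ℂ) :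
    ∑ x : ZMod p, χ (a * x ^ r * (x + v)⁻¹) =
      χ (a * (-v) ^ r * v⁻¹) * jacobiSum (χ ^ r) χ⁻¹ := by
  rw [jacobiSum, Finset.mul_sum, ← Equiv.sum_comp (Equiv.mulLeft₀ (-v) (neg_ne_zero.mpr hv))]
  refine Finset.sum_congr rfl fun y _ => ?_
  rw [MulChar.inv_apply', MulChar.pow_apply' _ hr, ← map_pow χ, ← map_mul χ, ← map_mul χ]
  congr 1
  have : (Equiv.mulLeft₀ (-v) (neg_ne_zero.mpr hv)) y + v = v * (1 - y) := by
    simp; ring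
  rw [this, mul_inv]
  simp only [Equiv.mulLeft₀_apply]
  ring

/-- Orthogonality: counting solutions by characters. -/
lemma count_eq (p : ℕ) [Fact p.Prime] (r : ℕ) (hr : r ≠ 0) (a v : ZMod p) (ha : a ≠ 0) :
    ((p - 1 : ℕ) : ℂ) *
      ((Finset.univ.filter (fun x : ZMod p => x ≠ 0 ∧ a * x ^ r = x + v)).card : ℂ) =
      ∑ χ : DirichletCharacter ℂ p, ∑ x : ZMod p, χ (a * x ^ r * (x + v)⁻¹) := by
  rw [Finset.sum_comm]
  simp_rw [DirichletCharacter.sum_characters_eq]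
  rw [← Finset.sum_filter, Finset.sum_const, nsmul_eq_mul, mul_comm,
    Nat.totient_prime Fact.out]
  congr 3
  ext x
  simp only [Finset.mem_filter, Finset.mem_univ, true_and]
  constructor
  · rintro ⟨h0, h1⟩
    rw [h1]
    apply mul_inv_cancel₀
    rw [← h1]
    exact mul_ne_zero ha (pow_ne_zero _ h0)
  · intro h
    have h2 : x + v ≠ 0 := by
      intro h2
      simp [h2] at h
    refine ⟨?_, ?_⟩
    · rintro rfl
      simp [hr] at h
    · rwa [← div_eq_mul_inv, div_eq_one_iff_eq h2] at h

/-- For a prime `p ≥ 5`, an exponent `r` with `gcd(r, p-1) = 1` and `1 < r < p-1`,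
and `a, v ∈ F_p` both nonzero, the number of nonzero solutions `x ∈ F_p` of
`a·x^r = x + v` is at most `1 + (1 - 2/(p-1))·√p`. -/
theorem count_solutions_welch_equation (p : ℕ) [Fact p.Prime] (hp5 : 5 ≤ p)
    (r : ℕ) (hgcd : Nat.gcd r (p - 1) = 1) (hr1 : 1 < r) (hr2 : r < p - 1)
    (a v : ZMod p) (ha : a ≠ 0) (hv : v ≠ 0) :
    ((Finset.univ.filter (fun x : ZMod p => x ≠ 0 ∧ a * x ^ r = x + v)).card : ℝ) ≤
      1 + (1 - 2 / ((p : ℝ) - 1)) * Real.sqrt p := by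
  have hpp : p.Prime := Fact.out
  have hr0 : r ≠ 0 := by omega
  have hev : 2 ∣ p - 1 := by
    have := hpp.eq_two_or_odd
    omega
  have hrodd : r % 2 = 1 := by
    by_contra hcon
    have h2 : 2 ∣ Nat.gcd r (p - 1) := Nat.dvd_gcd (by omega) hev
    rw [hgcd] at h2
    omega
  obtain ⟨q, hq⟩ : ∃ q : DirichletCharacter ℂ p, orderOf q = 2 :=
    MulChar.exists_mulChar_orderOf (F := ZMod p) (R := ℂ) (n := 2) (ζ := -1)
      (by rw [ZMod.card]; exact hev) (IsPrimitiveRoot.neg_one 0 (by norm_num))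
  have hq1 : q ≠ 1 := by
    rintro rfl
    simp at hq
  have hqr : q ^ r = q := by
    rw [← pow_mod_orderOf, hq, hrodd, pow_one]
  have hcard : Fintype.card (DirichletCharacter ℂ p) = p - 1 := by
    rw [← Nat.card_eq_fintype_card,
      DirichletCharacter.card_eq_totient_of_hasEnoughRootsOfUnity, Nat.totient_prime hpp]
  set S : DirichletCharacter ℂ p → ℂ := fun χ => ∑ x : ZMod p, χ (a * x ^ r * (x + v)⁻¹)
    with hS
  have hSle : ∀ χ, ‖S χ‖ ≤ ‖jacobiSum (χ ^ r) χ⁻¹‖ := by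
    intro χ
    rw [hS]
    simp only
    rw [charSum_eq p r hr0 a v hv χ, norm_mul]
    exact mul_le_of_le_one_left (norm_nonneg _) (DirichletCharacter.norm_le_one χ _)
  have hpow : ∀ χ : DirichletCharacter ℂ p, χ ≠ 1 → χ ^ r ≠ 1 := by
    intro χ hχ h
    apply hχ
    have h1 : orderOf χ ∣ r := orderOf_dvd_of_pow_eq_one h
    have h2 : orderOf χ ∣ p - 1 := hcard ▸ orderOf_dvd_card
    have h3 := Nat.dvd_gcd h1 h2
    rw [hgcd, Nat.dvd_one] at h3
    exact orderOf_eq_one_iff.mp h3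
  have hB : ∀ χ, χ ≠ 1 → ‖S χ‖ ≤ Real.sqrt p := fun χ hχ =>
    (hSle χ).trans (norm_jacobiSum_le p (hpow χ hχ) (inv_ne_one.mpr hχ))
  have hB1 : ‖S 1‖ ≤ (p : ℝ) - 2 := by
    refine (hSle 1).trans ?_
    rw [one_pow, inv_one, jacobiSum_one_one, ZMod.card]
    have : ((p : ℂ) - 2) = ((p - 2 : ℕ) : ℂ) := by
      rw [Nat.cast_sub (by omega)]; norm_num
    rw [this, Complex.norm_natCast, Nat.cast_sub (by omega)]
    norm_num
  have hBq : ‖S q‖ ≤ 1 := by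
    refine (hSle q).trans ?_
    rw [hqr, jacobiSum_nontrivial_inv hq1, norm_neg]
    exact DirichletCharacter.norm_le_one q _
  have hsum : ‖∑ χ, S χ‖ ≤ ((p : ℝ) - 2) + (1 + ((p : ℝ) - 3) * Real.sqrt p) := by
    classical
    refine (norm_sum_le _ _).trans ?_
    rw [← Finset.add_sum_erase _ _ (Finset.mem_univ (1 : DirichletCharacter ℂ p)),
      ← Finset.add_sum_erase _ _ (Finset.mem_erase.mpr ⟨hq1, Finset.mem_univ q⟩)]
    refine add_le_add hB1 (add_le_add hBq ?_)
    refine (Finset.sum_le_card_nsmul _ _ (Real.sqrt p) ?_).trans (le_of_eq ?_)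
    · intro χ hχ
      simp only [Finset.mem_erase] at hχ
      exact hB χ hχ.2.1
    · rw [Finset.card_erase_of_mem (Finset.mem_erase.mpr ⟨hq1, Finset.mem_univ q⟩),
        Finset.card_erase_of_mem (Finset.mem_univ _), Finset.card_univ, hcard, nsmul_eq_mul,
        show p - 1 - 1 - 1 = p - 3 by omega, Nat.cast_sub (by omega)]
      norm_num
  rw [← count_eq p r hr0 a v ha, norm_mul, Complex.norm_natCast, Complex.norm_natCast,
    Nat.cast_sub (by omega), Nat.cast_one] at hsum
  have hp1 : (0 : ℝ) < (p : ℝ) - 1 := by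
    have : (5 : ℝ) ≤ p := by exact_mod_cast hp5
    linarith
  refine le_of_mul_le_mul_left (hsum.trans (le_of_eq ?_)) hp1
  field_simp
  ring
end

section
/- Let q be an odd prime power, let r be an integer with gcd(r, q−1) = 1 and 1 < r < q−1, and let a, b be elements of the finite field F_q with b ≠ 0, a ≠ 0 and a ≠ 1. Then the number of y ∈ F_q with y ≠ 0 and y ≠ 1 satisfying b·(1−y)^r = 1 − a·y is at most 1 + (1 − 2/(q−1))·q^{1/2}. -/
open MulChar in
theorem golomb_char_sum {F : Type*} [Field F] [Fintype F] [DecidableEq F]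
    [Fintype (MulChar F ℂ)] (x : F) :
    ∑ χ : MulChar F ℂ, χ x = if x = 1 then ((Fintype.card F : ℂ) - 1) else 0 := by
  have : NeZero (Monoid.exponent Fˣ) := ⟨Monoid.exponent_ne_zero_of_finite⟩
  split_ifs with hx
  · subst hx
    have h := MulChar.card_eq_card_units_of_hasEnoughRootsOfUnity F ℂ
    rw [Nat.card_eq_fintype_card, Nat.card_eq_fintype_card, Fintype.card_units] at h
    simp only [map_one, Finset.sum_const, Finset.card_univ, h, nsmul_eq_mul, mul_one]
    rw [Nat.cast_sub Fintype.card_pos, Nat.cast_one]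
  · obtain ⟨χ, hχ⟩ := MulChar.exists_apply_ne_one_of_hasEnoughRootsOfUnity F ℂ hx
    refine eq_zero_of_mul_eq_self_left hχ ?_
    simp only [Finset.mul_sum, ← MulChar.mul_apply]
    exact Fintype.sum_bijective _ (Group.mulLeft_bijective χ) _ _ fun χ' ↦ rfl

theorem golomb_norm_char {F : Type*} [Field F] [Fintype F] (χ : MulChar F ℂ) {x : F}
    (hx : x ≠ 0) : ‖χ x‖ = 1 := by
  have h : χ x * χ x⁻¹ = 1 := by rw [← map_mul, mul_inv_cancel₀ hx, map_one]
  rw [← MulChar.inv_apply', ← MulChar.star_apply', RCLike.star_def, Complex.mul_conj,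
    Complex.normSq_eq_norm_sq] at h
  have h2 : ‖χ x‖ ^ 2 = 1 := by exact_mod_cast h
  exact (pow_eq_one_iff_of_nonneg (norm_nonneg _) two_ne_zero).mp h2

theorem golomb_norm_jacobi {F : Type*} [Field F] [Fintype F] (χ φ : MulChar F ℂ)
    (hχ : χ ≠ 1) (hφ : φ ≠ 1) : ‖jacobiSum χ φ‖ ≤ Real.sqrt (Fintype.card F) := by
  by_cases h : χ * φ = 1
  · obtain rfl : φ = χ⁻¹ := (inv_eq_of_mul_eq_one_right h).symm
    rw [jacobiSum_nontrivial_inv hχ, norm_neg, golomb_norm_char _ (by simp)]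
    rw [Real.one_le_sqrt]
    exact_mod_cast Fintype.card_pos
  · have hc : ringChar ℂ ≠ ringChar F := by
      rw [ringChar.eq_zero]
      exact (CharP.ringChar_ne_zero_of_finite F).symm
    have h2 := jacobiSum_mul_jacobiSum_inv hc hχ hφ h
    have h3 : jacobiSum χ⁻¹ φ⁻¹ = (starRingEnd ℂ) (jacobiSum χ φ) := by
      simp only [jacobiSum, map_sum, map_mul, ← MulChar.star_apply', RCLike.star_def]
    rw [h3, Complex.mul_conj, Complex.normSq_eq_norm_sq] at h2
    have h4 : ‖jacobiSum χ φ‖ ^ 2 = Fintype.card F := by exact_mod_cast h2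
    rw [← h4, Real.sqrt_sq (norm_nonneg _)]

theorem golomb_count {F : Type*} [Field F] [Fintype F] [DecidableEq F]
    [Fintype (MulChar F ℂ)] (r : ℕ) (hr : 0 < r) (f : F) :
    ((Finset.univ.filter (fun v : F => v ^ r * (1 - v)⁻¹ * f = 1)).card : ℂ)
        * ((Fintype.card F : ℂ) - 1) =
      ∑ χ : MulChar F ℂ, χ f * jacobiSum (χ ^ r) χ⁻¹ := by
  have h1 : ∀ χ : MulChar F ℂ, χ f * jacobiSum (χ ^ r) χ⁻¹
      = ∑ v : F, χ (v ^ r * (1 - v)⁻¹ * f) := by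
    intro χ
    rw [jacobiSum, Finset.mul_sum]
    refine Finset.sum_congr rfl fun v _ => ?_
    rw [map_mul, map_mul, map_pow, MulChar.inv_apply', MulChar.pow_apply' _ hr.ne']
    ring
  simp_rw [h1]
  rw [Finset.sum_comm]
  simp_rw [golomb_char_sum]
  rw [← Finset.sum_filter, Finset.sum_const, nsmul_eq_mul]

theorem golomb_bound {F : Type*} [Field F] [Fintype F] [DecidableEq F]
    (hodd : Odd (Fintype.card F)) (r : ℕ) (hgcd : Nat.gcd r (Fintype.card F - 1) = 1)
    (hr : 0 < r) (f : F) (hf : f ≠ 0) :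
    ((Finset.univ.filter (fun v : F => v ^ r * (1 - v)⁻¹ * f = 1)).card : ℝ)
        * ((Fintype.card F : ℝ) - 1) ≤
      ((Fintype.card F : ℝ) - 1) + ((Fintype.card F : ℝ) - 3) * Real.sqrt (Fintype.card F) := by
  classical
  have : NeZero (Monoid.exponent Fˣ) := ⟨Monoid.exponent_ne_zero_of_finite⟩
  let _ : Fintype (MulChar F ℂ) := Fintype.ofFinite _
  have hcard : Fintype.card (MulChar F ℂ) = Fintype.card F - 1 := by
    have h := MulChar.card_eq_card_units_of_hasEnoughRootsOfUnity F ℂ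
    rwa [Nat.card_eq_fintype_card, Nat.card_eq_fintype_card, Fintype.card_units] at h
  have hq1 : 1 < Fintype.card F := Fintype.one_lt_card
  have hchar : ringChar F ≠ 2 := by
    intro h
    have := FiniteField.even_card_of_char_two h
    obtain ⟨k, hk⟩ := hodd
    omega
  have hrodd : Odd r := by
    rw [← Nat.not_even_iff_odd]
    intro he
    have h2 : 2 ∣ Nat.gcd r (Fintype.card F - 1) := by
      refine Nat.dvd_gcd he.two_dvd ?_
      obtain ⟨k, hk⟩ := hodd
      exact ⟨k, by omega⟩
    rw [hgcd] at h2
    omega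
  obtain ⟨η, hη1, hη2⟩ : ∃ η : MulChar F ℂ, η ≠ 1 ∧ η ^ 2 = 1 := by
    refine ⟨(quadraticChar F).ringHomComp (Int.castRingHom ℂ), ?_, ?_⟩
    · exact (MulChar.ringHomComp_ne_one_iff (RingHom.injective_int _)).mpr
        (quadraticChar_ne_one hchar)
    · exact ((quadraticChar_isQuadratic F).comp _).sq_eq_one
  have hpow : ∀ χ : MulChar F ℂ, χ ≠ 1 → χ ^ r ≠ 1 := by
    intro χ hχ h
    have h1 : χ ^ (Fintype.card F - 1) = 1 := by rw [← hcard]; exact pow_card_eq_one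
    have h2 := Nat.dvd_gcd (orderOf_dvd_of_pow_eq_one h) (orderOf_dvd_of_pow_eq_one h1)
    rw [hgcd, Nat.dvd_one, orderOf_eq_one_iff] at h2
    exact hχ h2
  have hηr : η ^ r = η := by
    obtain ⟨k, rfl⟩ := hrodd
    rw [pow_succ, pow_mul, hη2, one_pow, one_mul]
  set q := Fintype.card F with hq
  have key := golomb_count r hr f
  set N := (Finset.univ.filter (fun v : F => v ^ r * (1 - v)⁻¹ * f = 1)).card
  have hnorm : (N : ℝ) * ((q : ℝ) - 1) = ‖(N : ℂ) * ((q : ℂ) - 1)‖ := by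
    have : (N : ℂ) * ((q : ℂ) - 1) = (((N : ℝ) * ((q : ℝ) - 1) : ℝ) : ℂ) := by push_cast; rfl
    rw [this, Complex.norm_real, Real.norm_of_nonneg]
    have : (1 : ℝ) < q := by exact_mod_cast hq1
    exact mul_nonneg (Nat.cast_nonneg _) (by linarith)
  have hq3 : 3 ≤ q := by obtain ⟨k, hk⟩ := hodd; omega
  rw [hnorm, key]
  refine (norm_sum_le _ _).trans ?_
  rw [← Finset.add_sum_erase _ _ (Finset.mem_univ (1 : MulChar F ℂ)),
    ← Finset.add_sum_erase _ _ (Finset.mem_erase.mpr ⟨hη1, Finset.mem_univ η⟩)]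
  have b1 : ‖(1 : MulChar F ℂ) f * jacobiSum ((1 : MulChar F ℂ) ^ r) (1 : MulChar F ℂ)⁻¹‖
      ≤ (q : ℝ) - 2 := by
    rw [norm_mul, golomb_norm_char _ hf, one_mul, one_pow, inv_one, jacobiSum_one_one]
    have : ((Fintype.card F : ℂ) - 2) = (((q : ℝ) - 2 : ℝ) : ℂ) := by push_cast; rfl
    rw [this, Complex.norm_real, Real.norm_of_nonneg]
    have : (3 : ℝ) ≤ q := by exact_mod_cast hq3
    linarith
  have b2 : ‖η f * jacobiSum (η ^ r) η⁻¹‖ ≤ 1 := by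
    rw [norm_mul, golomb_norm_char _ hf, one_mul, hηr, jacobiSum_nontrivial_inv hη1, norm_neg,
      golomb_norm_char _ (by simp)]
  have b3 : ∑ χ ∈ (Finset.univ.erase (1 : MulChar F ℂ)).erase η,
      ‖χ f * jacobiSum (χ ^ r) χ⁻¹‖ ≤ ((q : ℝ) - 3) * Real.sqrt q := by
    have h := Finset.sum_le_card_nsmul ((Finset.univ.erase (1 : MulChar F ℂ)).erase η)
      (fun χ => ‖χ f * jacobiSum (χ ^ r) χ⁻¹‖) (Real.sqrt q) (by
        intro χ hχ
        simp only [Finset.mem_erase, Finset.mem_univ, and_true] at hχ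
        rw [norm_mul, golomb_norm_char _ hf, one_mul]
        exact golomb_norm_jacobi _ _ (hpow χ hχ.2) (inv_ne_one.mpr hχ.2))
    rw [Finset.card_erase_of_mem (Finset.mem_erase.mpr ⟨hη1, Finset.mem_univ η⟩),
      Finset.card_erase_of_mem (Finset.mem_univ _), Finset.card_univ, hcard, nsmul_eq_mul] at h
    have e : ((q - 1 - 1 - 1 : ℕ) : ℝ) = (q : ℝ) - 3 := by
      rw [show q - 1 - 1 - 1 = q - 3 by omega, Nat.cast_sub hq3]; norm_num
    rwa [e] at h
  linarith

/-- For an odd prime power `q`, an exponent `r` with `gcd(r, q-1) = 1` and `1 < r < q-1`,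
and `a, b ∈ F_q` with `b ≠ 0`, `a ≠ 0`, `a ≠ 1`, the number of solutions
`y ∈ F_q \ {0,1}` of `b·(1-y)^r = 1 - a·y` is at most `1 + (1 - 2/(q-1))·√q`. -/
theorem count_solutions_golomb_equation_odd (q : ℕ) (hodd : Odd q)
    (F : Type*) [Field F] [Fintype F] [DecidableEq F] (hF : Fintype.card F = q)
    (r : ℕ) (hgcd : Nat.gcd r (q - 1) = 1) (hr1 : 1 < r) (hr2 : r < q - 1)
    (a b : F) (hb : b ≠ 0) (ha0 : a ≠ 0) (ha1 : a ≠ 1) :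
    ((Finset.univ.filter
        (fun y : F => y ≠ 0 ∧ y ≠ 1 ∧ b * (1 - y) ^ r = 1 - a * y)).card : ℝ) ≤
      1 + (1 - 2 / ((q : ℝ) - 1)) * Real.sqrt q := by
  subst hF
  have h1a : (1 - a) ≠ 0 := sub_ne_zero.mpr ha1.symm
  have hbd := golomb_bound hodd r hgcd (by omega) (b / (1 - a) * (-(1 - a) / a) ^ r)
    (mul_ne_zero (div_ne_zero hb h1a) (pow_ne_zero _ (div_ne_zero (neg_ne_zero.mpr h1a) ha0)))
  set f := b / (1 - a) * (-(1 - a) / a) ^ r with hf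
  have hle : (Finset.univ.filter
        (fun y : F => y ≠ 0 ∧ y ≠ 1 ∧ b * (1 - y) ^ r = 1 - a * y)).card ≤
      (Finset.univ.filter (fun v : F => v ^ r * (1 - v)⁻¹ * f = 1)).card := by
    refine Finset.card_le_card_of_injOn (fun y => (-a / (1 - a)) * (1 - y)) ?_ ?_
    · intro y hy
      simp only [Finset.coe_filter, Finset.mem_univ, true_and, Set.mem_ofPred_eq] at hy ⊢
      obtain ⟨-, hy1, hy⟩ := hy
      have hy0 : (1 - y) ≠ 0 := sub_ne_zero.mpr hy1.symm
      have hne : 1 - a * y ≠ 0 := by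
        rw [← hy]; exact mul_ne_zero hb (pow_ne_zero _ hy0)
      have e1 : 1 - -a / (1 - a) * (1 - y) = (1 - a * y) / (1 - a) := by
        field_simp; ring
      have e2 : (-a / (1 - a)) ^ r * (-(1 - a) / a) ^ r = 1 := by
        rw [← mul_pow]
        have : -a / (1 - a) * (-(1 - a) / a) = 1 := by field_simp
        rw [this, one_pow]
      rw [e1, hf, mul_pow, inv_div]
      calc _ = ((-a / (1 - a)) ^ r * (-(1 - a) / a) ^ r) *
            ((b * (1 - y) ^ r) / (1 - a * y)) * ((1 - a) / (1 - a)) := by ring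
        _ = 1 := by rw [e2, hy, div_self hne, div_self h1a]; ring
    · intro y _ z _ h
      have := mul_left_cancel₀ (div_ne_zero (neg_ne_zero.mpr ha0) h1a) h
      exact sub_right_injective this
  have hle' : ((Finset.univ.filter
        (fun y : F => y ≠ 0 ∧ y ≠ 1 ∧ b * (1 - y) ^ r = 1 - a * y)).card : ℝ) ≤
      ((Finset.univ.filter (fun v : F => v ^ r * (1 - v)⁻¹ * f = 1)).card : ℝ) := by
    exact_mod_cast hle
  refine hle'.trans ?_
  have hq1 : (0 : ℝ) < (Fintype.card F : ℝ) - 1 := by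
    have : (1 : ℝ) < Fintype.card F := by exact_mod_cast Fintype.one_lt_card
    linarith
  rw [← mul_le_mul_iff_left₀ hq1]
  refine hbd.trans (le_of_eq ?_)
  have hq0 := hq1.ne'
  field_simp
  ring
end

section
/- Let q ≥ 4 be an even prime power, let r be an integer with gcd(r, q−1) = 1 and 1 < r < q−1, and let a, b be elements of the finite field F_q with b ≠ 0, a ≠ 0 and a ≠ 1. Then the number of y ∈ F_q with y ≠ 0 and y ≠ 1 satisfying b·(1−y)^r = 1 − a·y is at most (1 − 1/(q−1))·(1 + q^{1/2}). -/
/-- In a finite field, `t ^ r = 1` with `r` coprime to `q - 1` forces `t = 1`. -/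
theorem golomb_pow_eq_one {F : Type*} [Field F] [Fintype F] (r : ℕ)
    (hgcd : Nat.gcd r (Fintype.card F - 1) = 1) (t : F) (ht : t ≠ 0) (h : t ^ r = 1) : t = 1 := by
  have h1 : orderOf t ∣ r := orderOf_dvd_of_pow_eq_one h
  have h2 : orderOf t ∣ Fintype.card F - 1 :=
    orderOf_dvd_of_pow_eq_one (FiniteField.pow_card_sub_one_eq_one t ht)
  have h3 := Nat.dvd_gcd h1 h2
  rw [hgcd, Nat.dvd_one] at h3
  exact orderOf_eq_one_iff.mp h3

/-- The ratio `t` of two solutions determines the second one. -/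
theorem golomb_ratio {F : Type*} [Field F] (r : ℕ) (a b y t : F)
    (h2 : b * (1 - y) ^ r = 1 - a * y)
    (h1 : b * (t * (1 - y)) ^ r = 1 - a * (1 - t * (1 - y))) :
    (1 - y) * (a * (t ^ r - t)) = (1 - a) * (1 - t ^ r) := by
  rw [mul_pow] at h1
  linear_combination h1 - t ^ r * h2

theorem golomb_real_bound (N s : ℝ) (hs : 2 ≤ s) (hN : 0 ≤ N) (h : N * (N - 1) ≤ s ^ 2 - 2) :
    N ≤ (1 - 1 / (s ^ 2 - 1)) * (1 + s) := by
  have hs1 : 0 < s - 1 := by linarith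
  have hs2 : s ^ 2 - 1 ≠ 0 := by nlinarith
  have e : (1 - 1 / (s ^ 2 - 1)) * (1 + s) = (s ^ 2 - 2) / (s - 1) := by
    field_simp
    ring
  rw [e, le_div_iff₀ hs1]
  by_contra! hc
  have h1 : s ^ 2 - s - 1 < (N - 1) * (s - 1) := by linarith
  have h3 : (s - 1) ^ 2 ≤ s ^ 2 - s - 1 := by nlinarith
  have h4 : (s ^ 2 - 2) * (s - 1) ^ 2 < (N * (s - 1)) * ((N - 1) * (s - 1)) :=
    mul_lt_mul hc (by linarith) (by positivity) (by positivity)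
  nlinarith [mul_le_mul_of_nonneg_right h (sq_nonneg (s - 1))]

/-- For an even prime power `q ≥ 4`, an exponent `r` with `gcd(r, q-1) = 1` and
`1 < r < q-1`, and `a, b ∈ F_q` with `b ≠ 0`, `a ≠ 0`, `a ≠ 1`, the number of solutions
`y ∈ F_q \ {0,1}` of `b·(1-y)^r = 1 - a·y` is at most `(1 - 1/(q-1))·(1 + √q)`. -/
theorem count_solutions_golomb_equation_even (q : ℕ) (hq4 : 4 ≤ q) (heven : Even q)
    (F : Type*) [Field F] [Fintype F] [DecidableEq F] (hF : Fintype.card F = q)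
    (r : ℕ) (hgcd : Nat.gcd r (q - 1) = 1) (hr1 : 1 < r) (hr2 : r < q - 1)
    (a b : F) (hb : b ≠ 0) (ha0 : a ≠ 0) (ha1 : a ≠ 1) :
    ((Finset.univ.filter
        (fun y : F => y ≠ 0 ∧ y ≠ 1 ∧ b * (1 - y) ^ r = 1 - a * y)).card : ℝ) ≤
      (1 - 1 / ((q : ℝ) - 1)) * (1 + Real.sqrt q) := by
  subst hF
  set S := Finset.univ.filter
        (fun y : F => y ≠ 0 ∧ y ≠ 1 ∧ b * (1 - y) ^ r = 1 - a * y) with hS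
  have key : S.offDiag.card ≤ ((Finset.univ.erase (0 : F)).erase 1).card := by
    have hx : ∀ y ∈ S, 1 - y ≠ 0 ∧ b * (1 - y) ^ r = 1 - a * y := by
      intro y hy
      simp only [hS, Finset.mem_filter] at hy
      exact ⟨sub_ne_zero.mpr (Ne.symm hy.2.2.1), hy.2.2.2⟩
    apply Finset.card_le_card_of_injOn (fun p => (1 - p.1) / (1 - p.2))
    · rintro ⟨y, z⟩ hp
      have hp' := Finset.mem_offDiag.mp hp
      obtain ⟨hy, hz, hne⟩ := hp'
      have h1 := (hx y hy).1
      have h2 := (hx z hz).1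
      simp only [Finset.coe_erase, Finset.coe_univ, Set.mem_diff, Set.mem_univ,
        Set.mem_singleton_iff, true_and]
      refine ⟨div_ne_zero h1 h2, fun h => hne ?_⟩
      rw [div_eq_one_iff_eq h2] at h
      simpa using h
    · rintro ⟨y, z⟩ hp ⟨y', z'⟩ hp' heq
      obtain ⟨hy, hz, hne⟩ := Finset.mem_offDiag.mp hp
      obtain ⟨hy', hz', hne'⟩ := Finset.mem_offDiag.mp hp'
      obtain ⟨y0, ey⟩ := hx y hy
      obtain ⟨z0, ez⟩ := hx z hz
      obtain ⟨y0', ey'⟩ := hx y' hy'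
      obtain ⟨z0', ez'⟩ := hx z' hz'
      simp only at heq hne hne'
      obtain ⟨t, ht⟩ : ∃ t, t = (1 - y) / (1 - z) := ⟨_, rfl⟩
      have t0 : t ≠ 0 := ht ▸ div_ne_zero y0 z0
      have hyt : 1 - y = t * (1 - z) := by rw [ht]; field_simp
      have hyt' : 1 - y' = t * (1 - z') := by rw [ht, heq]; field_simp
      have g : (1 - z) * (a * (t ^ r - t)) = (1 - a) * (1 - t ^ r) := by
        refine golomb_ratio r a b z t ez ?_
        rw [← hyt, ey]; ring
      have g' : (1 - z') * (a * (t ^ r - t)) = (1 - a) * (1 - t ^ r) := by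
        refine golomb_ratio r a b z' t ez' ?_
        rw [← hyt', ey']; ring
      have t1 : t ≠ 1 := by
        rintro rfl
        apply hne
        linear_combination -hyt
      have tr : t ^ r ≠ 1 := fun h => t1 (golomb_pow_eq_one r hgcd t t0 h)
      have hrhs : (1 - a) * (1 - t ^ r) ≠ 0 :=
        mul_ne_zero (sub_ne_zero.mpr ha1.symm) (sub_ne_zero.mpr tr.symm)
      have hc : a * (t ^ r - t) ≠ 0 := by
        intro h
        rw [h, mul_zero] at g
        exact hrhs g.symm
      have hzz : 1 - z = 1 - z' := mul_right_cancel₀ hc (g.trans g'.symm)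
      have hz2 : z = z' := by linear_combination -hzz
      have hy2 : y = y' := by
        subst hz2
        linear_combination hyt' - hyt
      rw [hz2, hy2]
  rw [Finset.offDiag_card, Finset.card_erase_of_mem (by simp), Finset.card_erase_of_mem (by simp),
    Finset.card_univ] at key
  have hkey : (S.card : ℝ) * (S.card - 1) ≤ (Fintype.card F : ℝ) - 2 := by
    have h' : S.card * S.card + 2 ≤ Fintype.card F + S.card := by omega
    have h'' : (S.card : ℝ) * S.card + 2 ≤ Fintype.card F + S.card := by exact_mod_cast h'
    linarith
  have hsq : Real.sqrt (Fintype.card F) ^ 2 = (Fintype.card F : ℝ) := Real.sq_sqrt (by positivity)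
  have hs2 : 2 ≤ Real.sqrt (Fintype.card F) := by
    apply Real.le_sqrt_of_sq_le
    have : (4 : ℝ) ≤ Fintype.card F := by exact_mod_cast hq4
    linarith
  have := golomb_real_bound S.card _ hs2 (by positivity) (by rw [hsq]; exact hkey)
  rwa [hsq] at this
end

section
/- Let q ≥ 4 be an even prime power such that q−1 is not prime, and let t be the smallest prime divisor of q−1. Then ⌊(1 − 1/(q−1))·(1 + q^{1/2})⌋ ≤ (q−1)/t − 1. -/
/-- For a power of two `q ≥ 4` with `q-1` not prime, and `t` the smallest prime divisor
of `q-1`, we have `⌊(1 - 1/(q-1))·(1 + √q)⌋ ≤ (q-1)/t - 1`. -/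
theorem golomb_bound_comparison_even (q : ℕ) (hq4 : 4 ≤ q) (hq : ∃ k : ℕ, q = 2 ^ k)
    (hcomp : ¬ Nat.Prime (q - 1)) (t : ℕ) (ht : t = (q - 1).minFac) :
    ⌊(1 - 1 / ((q : ℝ) - 1)) * (1 + Real.sqrt q)⌋ ≤ (((q - 1) / t : ℕ) : ℤ) - 1 := by
  obtain ⟨m, hm⟩ : t ∣ q - 1 := ht ▸ Nat.minFac_dvd _
  have htpos : 0 < t := ht ▸ Nat.minFac_pos _
  have hsq : t ^ 2 ≤ q - 1 := ht ▸ Nat.minFac_sq_le_self (by omega) hcomp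
  have h4 : 4 ∣ q := by
    obtain ⟨k, rfl⟩ := hq
    have hk : 2 ≤ k := by
      by_contra h
      have : k = 0 ∨ k = 1 := by omega
      rcases this with rfl | rfl <;> norm_num at hq4
    exact pow_dvd_pow 2 hk
  have hmod : (t * m) % 4 = 3 := by omega
  have hle : t ≤ m := by
    rw [hm, pow_two] at hsq
    exact Nat.le_of_mul_le_mul_left hsq htpos
  have h2 : t + 2 ≤ m := by
    by_contra h
    have h' : m = t ∨ m = t + 1 := by omega
    have h5 : t % 4 = 0 ∨ t % 4 = 1 ∨ t % 4 = 2 ∨ t % 4 = 3 := by omega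
    rcases h' with rfl | rfl <;> rcases h5 with h5 | h5 | h5 | h5 <;>
      simp [Nat.mul_mod, Nat.add_mod, h5] at hmod
  have hdiv : (q - 1) / t = m := by rw [hm]; exact Nat.mul_div_cancel_left _ htpos
  rw [hdiv]
  apply Int.le_sub_one_of_lt
  rw [Int.floor_lt]
  have hqm : (q : ℝ) = t * m + 1 := by
    have : q = t * m + 1 := by omega
    exact_mod_cast this
  have h2r : (t : ℝ) + 2 ≤ m := by exact_mod_cast h2
  have htr : (0 : ℝ) < t := by exact_mod_cast htpos
  have hs : Real.sqrt q ≤ m - 1 := by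
    apply Real.sqrt_le_iff.2
    constructor
    · linarith
    · nlinarith
  have hq1 : (0 : ℝ) < 1 / ((q : ℝ) - 1) := by
    have : (4 : ℝ) ≤ q := by exact_mod_cast hq4
    apply one_div_pos.2
    linarith
  have hs0 := Real.sqrt_nonneg (q : ℝ)
  push_cast
  nlinarith
end
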